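/- Let I be an arbitrary set and for each i ∈ I let E_i be a nonempty set. Let E = Π_{i ∈ I} E_i and let 𝔤 be the real vector space of all functions from E to ℝ. For a finite subset a of I (a ∈ Finset I), let F(a) be the subspace of 𝔤 consisting of the functions f : E → ℝ that factor through the restriction map π_a : E → Π_{i ∈ a} E_i (i.e. there exists g : (Π_{i ∈ a} E_i) → ℝ with f = g ∘ π_a). Then the monotone map F from the poset of finite subsets of I (ordered by inclusion) to Submodule ℝ 𝔤 is decomposable: there exists a family s indexed by the finite subsets of I which is independent (for every finite a ⊆ I, s a ⊓ (⨆_{b finite, b ≠ a} s b) = ⊥) and satisfies F(a) = ⨆_{b ⊆ a} s b for every finite a ⊆ I. -/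

import Mathlib

/-- The factor subspace `F a ≤ (E → ℝ)`, for a finite subset `a : Finset I`, of
functions factoring through the restriction map `π_a : (∀ i, E i) → (∀ i : a, E i)`. -/
def factorSubspaceFinset {I : Type*} (E : I → Type*) (a : Finset I) :
    Submodule ℝ ((∀ i, E i) → ℝ) :=
  LinearMap.range (LinearMap.funLeft ℝ ℝ (fun (x : ∀ i, E i) (i : a) => x i.1))

theorem mem_factorSubspaceFinset_iff {I : Type*} {E : I → Type*} (o : ∀ i, E i) {a : Finset I}
    {f : (∀ i, E i) → ℝ} :
    f ∈ factorSubspaceFinset E a ↔ ∀ x y : ∀ i, E i, (∀ i ∈ a, x i = y i) → f x = f y := by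
  classical
  constructor
  · rintro ⟨g, rfl⟩ x y h
    simp only [LinearMap.funLeft_apply]
    congr 1
    funext i
    exact h i i.2
  · intro h
    refine ⟨fun z => f fun i => if hi : i ∈ a then z ⟨i, hi⟩ else o i, ?_⟩
    funext x
    simp only [LinearMap.funLeft_apply]
    exact h _ _ fun i hi => by simp [hi]

/-- The functions in the factor subspace of `a` that vanish at every point sharing a coordinate of
index in `a` with the base point `o`. -/
def interactionSubspace {I : Type*} {E : I → Type*} (o : ∀ i, E i) (a : Finset I) :
    Submodule ℝ ((∀ i, E i) → ℝ) where
  carrier := {f | f ∈ factorSubspaceFinset E a ∧ ∀ x, ∀ i ∈ a, x i = o i → f x = 0}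
  add_mem' hf hg := ⟨add_mem hf.1 hg.1, fun x i hi hx => by
    simp [hf.2 x i hi hx, hg.2 x i hi hx]⟩
  zero_mem' := ⟨zero_mem _, fun _ _ _ _ => rfl⟩
  smul_mem' c _ hf := ⟨Submodule.smul_mem _ c hf.1, fun x i hi hx => by
    simp [hf.2 x i hi hx]⟩

theorem iSupIndep_interactionSubspace {I : Type*} {E : I → Type*} (o : ∀ i, E i) :
    iSupIndep (interactionSubspace o) := by
  classical
  apply iSupIndep_of_dfinsupp_lsum_injective
  rw [injective_iff_map_eq_zero]
  intro m hm
  have hsum (x : ∀ i, E i) : ∑ b ∈ m.support, (m b : (∀ i, E i) → ℝ) x = 0 := by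
    have := congrFun hm x
    simpa [DFinsupp.sumAddHom_apply, DFinsupp.sum, Finset.sum_apply] using this
  ext1 a
  induction a using Finset.strongInduction with
  | H a ih =>
    ext x
    have hx := hsum fun i => if i ∈ a then x i else o i
    rw [Finset.sum_eq_single a] at hx
    · rw [← (mem_factorSubspaceFinset_iff o).1 (m a).2.1 _ x fun i hi => if_pos hi]
      exact hx
    · intro b _ hba
      by_cases hb : b ⊆ a
      · simp [ih b (hb.ssubset_of_ne hba)]
      · obtain ⟨i, hib, hia⟩ := Finset.not_subset.1 hb
        exact (m b).2.2 _ i hib (if_neg hia)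
    · intro ha
      simp [DFinsupp.notMem_support_iff.1 ha]

theorem mem_iSup_interactionSubspace {I : Type*} [DecidableEq I] {E : I → Type*} (o : ∀ i, E i)
    (a d : Finset I) : ∀ (u : Finset I) (f : (∀ i, E i) → ℝ), Disjoint u d → u ∪ d ⊆ a →
      f ∈ factorSubspaceFinset E (u ∪ d) → (∀ x, ∀ i ∈ u, x i = o i → f x = 0) →
      f ∈ ⨆ b, ⨆ _ : b ≤ a, interactionSubspace o b := by
  induction d using Finset.induction_on with
  | empty =>
    intro u f _ hu hf h0
    rw [Finset.union_empty] at hu hf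
    exact Submodule.mem_iSup_of_mem u (Submodule.mem_iSup_of_mem hu ⟨hf, h0⟩)
  | insert i d hid ih =>
    intro u f hdisj hu hf h0
    obtain ⟨hiu, hud⟩ := Finset.disjoint_insert_right.1 hdisj
    rw [mem_factorSubspaceFinset_iff o] at hf
    have hne {j : I} (hj : j ∈ u) : j ≠ i := fun h => hiu (h ▸ hj)
    let g : (∀ i, E i) → ℝ := fun x => f (Function.update x i (o i))
    have hg : g ∈ ⨆ b, ⨆ _ : b ≤ a, interactionSubspace o b := by
      refine ih u g hud (subset_trans (by grind) hu) ?_ fun x j hj hx =>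
        h0 _ j hj (by rwa [Function.update_of_ne (hne hj)])
      rw [mem_factorSubspaceFinset_iff o]
      refine fun x y hxy => hf _ _ fun j hj => ?_
      by_cases hji : j = i
      · subst hji; simp
      · rw [Function.update_of_ne hji, Function.update_of_ne hji]
        exact hxy j (by grind)
    have hfg : f - g ∈ ⨆ b, ⨆ _ : b ≤ a, interactionSubspace o b := by
      refine ih (insert i u) (f - g) (Finset.disjoint_insert_left.2 ⟨hid, hud⟩)
        (subset_trans (by grind) hu) ?_ fun x j hj hx => ?_
      · rw [mem_factorSubspaceFinset_iff o]
        intro x y hxy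
        have hxy' (j : I) (hj : j ∈ u ∪ insert i d) : x j = y j := hxy j (by grind)
        simp only [Pi.sub_apply, g]
        rw [hf x y hxy', hf (Function.update x i (o i)) (Function.update y i (o i))]
        intro j hj
        by_cases hji : j = i
        · subst hji; simp
        · rw [Function.update_of_ne hji, Function.update_of_ne hji]
          exact hxy' j hj
      · simp only [Pi.sub_apply, g]
        rcases Finset.mem_insert.1 hj with rfl | hj
        · rw [← hx, Function.update_eq_self, sub_self]
        · rw [h0 x j hj hx, h0 _ j hj (by rwa [Function.update_of_ne (hne hj)]), sub_self]
    simpa using add_mem hfg hg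

/-- For an arbitrary set `I` and nonempty sets `E i`, the monotone map
`a ↦ F a` on the poset of finite subsets of `I` (ordered by inclusion) is
decomposable. -/
theorem stmt_18 {I : Type*} (E : I → Type*) (hE : ∀ i, Nonempty (E i)) :
    ∃ s : Finset I → Submodule ℝ ((∀ i, E i) → ℝ),
      (∀ a : Finset I, s a ⊓ (⨆ b, ⨆ _ : b ≠ a, s b) = ⊥) ∧
      (∀ a : Finset I, factorSubspaceFinset E a = ⨆ b, ⨆ _ : b ≤ a, s b) := by
  classical
  let o : ∀ i, E i := fun i => (hE i).some
  refine ⟨interactionSubspace o, fun a => (iSupIndep_interactionSubspace o a).eq_bot,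
    fun a => le_antisymm (fun f hf => ?_) (iSup₂_le fun b hb f hf => ?_)⟩
  · exact mem_iSup_interactionSubspace o a a ∅ f (Finset.disjoint_empty_left a) (by simp)
      (by simpa using hf) (by simp)
  · rw [mem_factorSubspaceFinset_iff o]
    exact fun x y hxy =>
      (mem_factorSubspaceFinset_iff o).1 hf.1 x y fun i hi => hxy i (hb hi)
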